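/- (Dhage fixed point theorem in a Banach algebra.) Let $X$ be a Banach algebra, $r > 0$, and let $\overline{B_r(0)}$ denote the closed ball of radius $r$ centered at $0$. Let $A, B : \overline{B_r(0)} \to X$ be two operators such that: (a) $A$ is Lipschitz with constant $L_A$; (b) $B$ is continuous and $B(\overline{B_r(0)})$ is relatively compact; (c) $L_A M < 1$, where $M = \sup\{\|Bx\| : x \in \overline{B_r(0)}\}$. Then either (i) the equation $A x \cdot B x = x$ has a solution $x \in \overline{B_r(0)}$, or (ii) there exists $x \in X$ with $\|x\| = r$ and $\lambda \in (0,1)$ such that $\lambda (A x \cdot B x) = x$. -/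

import Mathlib

def ScarfDom {V I : Type*} (u : I → V → ℤ) (σ : Finset V) : Prop :=
  ∀ y, ∃ i, ∀ x ∈ σ, u i y ≤ u i x

lemma ScarfDom.mono {V I : Type*} {u : I → V → ℤ} {σ τ : Finset V} (h : ScarfDom u σ)
    (hs : τ ⊆ σ) : ScarfDom u τ := fun y => by
  obtain ⟨i, hi⟩ := h y
  exact ⟨i, fun x hx => hi x (hs hx)⟩

/-- a door whose candidate sets are nonempty lies in exactly two rooms -/
lemma scarf_door {V I : Type*} [Fintype V] [DecidableEq V] [Fintype I] [DecidableEq I]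
    (u : I → V → ℤ) (hu : ∀ i, Function.Injective (u i)) (τ : Finset V)
    (hτ : ScarfDom u τ) (hcard : τ.card + 1 = Fintype.card I) (hne : τ.Nonempty)
    (hM : ∀ k, ∃ y, ∀ l, l ≠ k → ∃ t ∈ τ, u l t < u l y) :
    ∃ a b, a ≠ b ∧ ∀ x, (x ∉ τ ∧ ScarfDom u (insert x τ)) ↔ (x = a ∨ x = b) := by
  classical
  have hm : ∀ i, ∃ z ∈ τ, ∀ x ∈ τ, u i z ≤ u i x := fun i => τ.exists_min_image (u i) hne
  choose m hmτ hmin using hm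
  have hchar : ∀ i z, z ∈ τ → (∀ x ∈ τ, u i z ≤ u i x) → m i = z := fun i z hz h =>
    hu i (le_antisymm (hmin i z hz) (h _ (hmτ i)))
  have hsurj : ∀ z ∈ τ, ∃ i, m i = z := fun z hz => by
    obtain ⟨i, hi⟩ := hτ z
    exact ⟨i, hchar i z hz hi⟩
  obtain ⟨i, -, j, -, hij, hmij⟩ : ∃ i ∈ (Finset.univ : Finset I), ∃ j ∈ (Finset.univ : Finset I),
      i ≠ j ∧ m i = m j :=
    Finset.exists_ne_map_eq_of_card_lt_of_maps_to (t := τ)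
      (by rw [Finset.card_univ]; omega) (fun i _ => hmτ i)
  -- if m is onto from the complement of k then it is injective there
  have hinj : ∀ k, (∀ z ∈ τ, ∃ l, l ≠ k ∧ m l = z) → ∀ a b, a ≠ k → b ≠ k → m a = m b → a = b := by
    intro k hk a b ha hb hab
    have := Finset.injOn_of_surjOn_of_card_le (s := Finset.univ.erase k) (t := τ) m
      (fun a _ => hmτ a) (fun z hz => by
        obtain ⟨l, hl, rfl⟩ := hk z hz
        exact ⟨l, by simpa using hl, rfl⟩)
      (by rw [Finset.card_erase_of_mem (Finset.mem_univ _), Finset.card_univ]; omega)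
    exact this (by simpa using ha) (by simpa using hb) hab
  have hgt : ∀ k, ∃ y, (∀ l, l ≠ k → u l (m l) < u l y) ∧
      ∀ y', (∀ l, l ≠ k → u l (m l) < u l y') → u k y' ≤ u k y := by
    intro k
    obtain ⟨y0, hy0⟩ := hM k
    obtain ⟨y, hy, hy'⟩ := (Finset.univ.filter fun y => ∀ l, l ≠ k → u l (m l) < u l y).exists_max_image
      (u k) ⟨y0, by
        simp only [Finset.mem_filter, Finset.mem_univ, true_and]
        intro l hl
        obtain ⟨t, ht, h⟩ := hy0 l hl
        exact lt_of_le_of_lt (hmin l t ht) h⟩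
    simp only [Finset.mem_filter, Finset.mem_univ, true_and] at hy hy'
    exact ⟨y, hy, hy'⟩
  choose w hw hwmax using hgt
  have hback : ∀ k k', k ≠ k' → m k = m k' → w k ∉ τ ∧ ScarfDom u (insert (w k) τ) := by
    intro k k' hkk hmk
    constructor
    · intro hx
      obtain ⟨l, hl⟩ := hsurj _ hx
      by_cases h : l = k
      · have := hw k k' hkk.symm
        rw [← hl, h, hmk] at this
        exact lt_irrefl _ this
      · have := hw k l h
        rw [← hl] at this
        exact lt_irrefl _ this
    · intro y
      by_cases h : ∀ l, l ≠ k → u l (m l) < u l y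
      · refine ⟨k, fun x hx => ?_⟩
        rcases Finset.mem_insert.1 hx with rfl | hx
        · exact hwmax k y h
        · obtain ⟨l, hl⟩ := hτ y
          by_cases hlk : l = k
          · rw [← hlk]; exact hl x hx
          · exact absurd (hl _ (hmτ l)) (not_le.2 (h l hlk))
      · push Not at h
        obtain ⟨l, hl, hy⟩ := h
        refine ⟨l, fun x hx => ?_⟩
        rcases Finset.mem_insert.1 hx with rfl | hx
        · exact hy.trans (hw k l hl).le
        · exact hy.trans (hmin l x hx)
  refine ⟨w i, w j, ?_, fun x => ⟨?_, ?_⟩⟩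
  · intro h
    obtain ⟨l, hl⟩ := hτ (w i)
    have h1 := hl _ (hmτ l)
    by_cases hli : l = i
    · have := hw j l (by rw [hli]; exact hij)
      rw [← h] at this
      omega
    · have := hw i l hli
      omega
  · rintro ⟨hx, hd⟩
    obtain ⟨k, hk⟩ := hd x
    have honto : ∀ z ∈ τ, ∃ l, l ≠ k ∧ m l = z ∧ u l z ≤ u l x := by
      intro z hz
      obtain ⟨l, hl⟩ := hd z
      refine ⟨l, ?_, hchar l z hz fun x hx => hl x (Finset.mem_insert_of_mem hx),
        hl x (Finset.mem_insert_self _ _)⟩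
      rintro rfl
      have h1 := hl x (Finset.mem_insert_self _ _)
      have h2 := hk z (Finset.mem_insert_of_mem hz)
      exact hx (hu l (le_antisymm h2 h1) ▸ hz)
    have hI := hinj k fun z hz => by
      obtain ⟨l, h1, h2, -⟩ := honto z hz
      exact ⟨l, h1, h2⟩
    have hxM : ∀ l, l ≠ k → u l (m l) < u l x := by
      intro l hl
      obtain ⟨l', h1, h2, h3⟩ := honto (m l) (hmτ l)
      have := hI l' l h1 hl h2
      subst this
      refine lt_of_le_of_ne h3 fun h => hx ?_
      rw [← hu _ h]; exact hmτ _
    have hxw : x = w k := by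
      refine hu k (le_antisymm (hwmax k x hxM) ?_)
      obtain ⟨l, hl⟩ := hd (w k)
      by_cases hlk : l = k
      · subst hlk; exact hl x (Finset.mem_insert_self _ _)
      · exact absurd (hl _ (Finset.mem_insert_of_mem (hmτ l))) (not_le.2 (hw k l hlk))
    by_cases hki : k = i
    · left; rw [hxw, hki]
    · by_cases hkj : k = j
      · right; rw [hxw, hkj]
      · exact absurd (hI i j (Ne.symm hki) (Ne.symm hkj) hmij) hij
  · rintro (rfl | rfl)
    · exact hback i j hij hmij
    · exact hback j i hij.symm hmij.symm

lemma scarf_room {V I : Type*} [DecidableEq V] [Fintype I] [DecidableEq I]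
    (c : V → I) (i0 : I) (σ : Finset V) (hcard : σ.card = Fintype.card I)
    (hσ : σ.image c ≠ Finset.univ) :
    Even (σ.filter fun x => (σ.erase x).image c = Finset.univ.erase i0).card := by
  classical
  by_cases h : ∃ x ∈ σ, (σ.erase x).image c = Finset.univ.erase i0
  swap
  · rw [Finset.filter_eq_empty_iff.2 fun x hx hh => h ⟨x, hx, hh⟩]; simp
  obtain ⟨x, hx, hxc⟩ := h
  have hinj : Set.InjOn c (σ.erase x : Finset V) := by
    apply Finset.injOn_of_card_image_eq
    rw [hxc, Finset.card_erase_of_mem hx, Finset.card_erase_of_mem (Finset.mem_univ _), hcard,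
      Finset.card_univ]
  have hcx : c x ≠ i0 := by
    intro h
    apply hσ
    rw [← Finset.insert_erase hx, Finset.image_insert, hxc, h,
      Finset.insert_erase (Finset.mem_univ _)]
  have : c x ∈ (σ.erase x).image c := by rw [hxc]; simpa using hcx
  obtain ⟨x', hx', hcx'⟩ := Finset.mem_image.1 this
  have hne : x' ≠ x := Finset.ne_of_mem_erase hx'
  have hx'σ := Finset.mem_of_mem_erase hx'
  have : (σ.filter fun x => (σ.erase x).image c = Finset.univ.erase i0) = {x, x'} := by
    ext w
    simp only [Finset.mem_filter, Finset.mem_insert, Finset.mem_singleton]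
    constructor
    · rintro ⟨hw, hwc⟩
      by_contra! hcon
      have h1 : c w ∈ (σ.erase w).image c := by
        rw [hwc, ← hxc]
        exact Finset.mem_image_of_mem _ (Finset.mem_erase.2 ⟨hcon.1, hw⟩)
      obtain ⟨v, hv, hvc⟩ := Finset.mem_image.1 h1
      obtain ⟨hvw, hvσ⟩ := Finset.mem_erase.1 hv
      by_cases hvx : v = x
      · subst hvx
        exact hcon.2 (hinj (Finset.mem_coe.2 (Finset.mem_erase.2 ⟨hcon.1, hw⟩)) (Finset.mem_coe.2 hx')
          (by rw [← hvc, hcx']))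
      · exact hvw (hinj (Finset.mem_coe.2 (Finset.mem_erase.2 ⟨hvx, hvσ⟩))
          (Finset.mem_coe.2 (Finset.mem_erase.2 ⟨hcon.1, hw⟩)) hvc)
    · rintro (rfl | rfl)
      · exact ⟨hx, hxc⟩
      · refine ⟨hx'σ, ?_⟩
        rw [← hxc]
        ext a
        simp only [Finset.mem_image, Finset.mem_erase]
        constructor
        · rintro ⟨v, ⟨h1, h2⟩, rfl⟩
          by_cases hvx : v = x
          · exact ⟨w, ⟨hne, hx'σ⟩, by rw [hcx', hvx]⟩
          · exact ⟨v, ⟨hvx, h2⟩, rfl⟩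
        · rintro ⟨v, ⟨h1, h2⟩, rfl⟩
          by_cases hvx : v = w
          · exact ⟨x, ⟨hne.symm, hx⟩, by rw [← hcx', hvx]⟩
          · exact ⟨v, ⟨hvx, h2⟩, rfl⟩
  rw [this, Finset.card_pair hne.symm]
  decide

lemma scarf {V I : Type*} [Fintype V] [DecidableEq V] [Fintype I] [DecidableEq I]
    (u : I → V → ℤ) (hu : ∀ i, Function.Injective (u i)) (s : I → V)
    (hs1 : ∀ i v, u i (s i) ≤ u i v)
    (hs2 : ∀ i j v, i ≠ j → v ∉ Set.range s → u j v < u j (s i))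
    (hT : ∃ v, v ∉ Set.range s) (c : V → I) (hc : ∀ i, c (s i) = i) (i0 : I) :
    ∃ x : I → V, (∀ i, c (x i) = i) ∧ ∀ y, ∃ i, ∀ j, u i y ≤ u i (x j) := by
  classical
  by_contra hcon
  have hnc : ∀ σ : Finset V, ScarfDom u σ → σ.image c ≠ Finset.univ := by
    intro σ hσ h
    apply hcon
    have : ∀ i, ∃ x ∈ σ, c x = i := fun i => by
      have : i ∈ σ.image c := by rw [h]; exact Finset.mem_univ _
      simpa using this
    choose x hx hxc using this
    refine ⟨x, hxc, fun y => ?_⟩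
    obtain ⟨i, hi⟩ := hσ y
    exact ⟨i, fun j => hi _ (hx j)⟩
  have sinj : Function.Injective s := fun a b h => by rw [← hc a, h, hc]
  let P : Finset (Finset V × V) := Finset.univ.filter fun p =>
    p.2 ∈ p.1 ∧ ScarfDom u p.1 ∧ p.1.card = Fintype.card I ∧
      (p.1.erase p.2).image c = Finset.univ.erase i0
  have hPe : Even P.card := by
    rw [Finset.card_eq_sum_card_fiberwise (f := Prod.fst) (t := Finset.univ)
      (fun _ _ => Finset.mem_coe.2 (Finset.mem_univ _))]
    apply Finset.even_sum
    intro σ _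
    by_cases hσ : ScarfDom u σ ∧ σ.card = Fintype.card I
    · have := scarf_room c i0 σ hσ.2 (hnc σ hσ.1)
      refine Eq.subst (motive := Even) (Eq.symm ?_) this
      refine Finset.card_bij' (fun p _ => p.2) (fun x _ => (σ, x)) ?_ ?_ ?_ ?_
      · rintro ⟨σ', x⟩ h
        simp only [P, Finset.mem_filter, Finset.mem_univ, true_and] at h
        obtain ⟨⟨h1, h2, h3, h4⟩, rfl⟩ := h
        simp [h1, h4]
      · intro x h
        simp only [Finset.mem_filter] at h
        simp [P, h, hσ.1, hσ.2]
      · rintro ⟨σ', x⟩ h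
        simp only [P, Finset.mem_filter, Finset.mem_univ, true_and] at h
        simp [h.2]
      · intro x h; rfl
    · rw [Finset.filter_eq_empty_iff.2]
      · simp
      · rintro ⟨σ', x⟩ h rfl
        simp only [P, Finset.mem_filter, Finset.mem_univ, true_and] at h
        exact hσ ⟨h.2.1, h.2.2.1⟩
  -- fibres over doors
  have hfib : ∀ τ : Finset V, (P.filter fun p => p.1.erase p.2 = τ).card =
      (Finset.univ.filter fun x => (x ∉ τ ∧ ScarfDom u (insert x τ)) ∧
        τ.card + 1 = Fintype.card I ∧ τ.image c = Finset.univ.erase i0).card := by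
    intro τ
    refine Finset.card_bij' (fun p _ => p.2) (fun x _ => (insert x τ, x)) ?_ ?_ ?_ ?_
    · rintro ⟨σ', x⟩ h
      simp only [P, Finset.mem_filter, Finset.mem_univ, true_and] at h
      obtain ⟨⟨h1, h2, h3, h4⟩, rfl⟩ := h
      simp only [Finset.mem_filter, Finset.mem_univ, true_and]
      refine ⟨⟨Finset.notMem_erase _ _, ?_⟩, ?_, h4⟩
      · rwa [Finset.insert_erase h1]
      · rw [Finset.card_erase_add_one h1, h3]
    · intro x h
      simp only [Finset.mem_filter, Finset.mem_univ, true_and] at h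
      obtain ⟨⟨h1, h2⟩, h3, h4⟩ := h
      simp [P, h2, Finset.erase_insert h1, h4, Finset.card_insert_of_notMem h1, h3]
    · rintro ⟨σ', x⟩ h
      simp only [P, Finset.mem_filter, Finset.mem_univ, true_and] at h
      obtain ⟨⟨h1, h2, h3, h4⟩, rfl⟩ := h
      simp [Finset.insert_erase h1]
    · intro x h; rfl
  let τ0 : Finset V := (Finset.univ.erase i0).image s
  have hτ0card : τ0.card + 1 = Fintype.card I := by
    rw [Finset.card_image_of_injective _ sinj, Finset.card_erase_add_one (Finset.mem_univ _),
      Finset.card_univ]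
  have hτ0c : τ0.image c = Finset.univ.erase i0 := by
    rw [Finset.image_image]
    have : c ∘ s = id := funext hc
    rw [this, Finset.image_id]
  have hmemτ0 : ∀ v, v ∈ τ0 ↔ ∃ i, i ≠ i0 ∧ s i = v := by intro v; simp [τ0]
  have hPo : Odd P.card := by
    rw [Finset.card_eq_sum_card_fiberwise (f := fun p => p.1.erase p.2) (t := Finset.univ)
      (fun _ _ => Finset.mem_coe.2 (Finset.mem_univ _)),
      ← Finset.add_sum_erase _ _ (Finset.mem_univ τ0)]
    apply Odd.add_even
    · rw [hfib]
      obtain ⟨v0, hv0⟩ := hT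
      obtain ⟨w, hw, hwmax⟩ := (Finset.univ.filter fun v => v ∉ Set.range s).exists_max_image (u i0)
        ⟨v0, by simpa using hv0⟩
      simp only [Finset.mem_filter, Finset.mem_univ, true_and] at hw hwmax
      have hnle : ∀ l y, y ∉ Set.range s → ¬ u l y ≤ u l (s l) := fun l y hy h =>
        hy ⟨l, hu l (le_antisymm (hs1 l y) h)⟩
      have : (Finset.univ.filter fun x => (x ∉ τ0 ∧ ScarfDom u (insert x τ0)) ∧
        τ0.card + 1 = Fintype.card I ∧ τ0.image c = Finset.univ.erase i0) = {w} := by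
        ext x
        simp only [Finset.mem_filter, Finset.mem_univ, true_and, Finset.mem_singleton, hτ0card,
          hτ0c, and_true]
        constructor
        · rintro ⟨h1, h2⟩
          obtain ⟨l, hl⟩ := h2 w
          have hli : l = i0 := by
            by_contra hli
            exact hnle l w hw (hl _ (Finset.mem_insert_of_mem ((hmemτ0 _).2 ⟨l, hli, rfl⟩)))
          subst hli
          have hwx := hl x (Finset.mem_insert_self _ _)
          have hxr : x ∉ Set.range s := by
            rintro ⟨i, rfl⟩
            by_cases hi : i = l
            · subst hi; exact hnle _ _ hw hwx
            · exact h1 ((hmemτ0 _).2 ⟨i, hi, rfl⟩)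
          exact hu l (le_antisymm (hwmax x hxr) hwx)
        · rintro rfl
          refine ⟨fun h => ?_, fun y => ?_⟩
          · obtain ⟨i, _, hi⟩ := (hmemτ0 _).1 h
            exact hw ⟨i, hi⟩
          · by_cases hy : y ∈ Set.range s
            · obtain ⟨i, rfl⟩ := hy
              exact ⟨i, fun x _ => hs1 i x⟩
            · refine ⟨i0, fun v hv => ?_⟩
              rcases Finset.mem_insert.1 hv with rfl | hv
              · exact hwmax y hy
              · obtain ⟨i, hi, rfl⟩ := (hmemτ0 _).1 hv
                exact (hs2 i i0 y hi hy).le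
      rw [this]; simp
    · apply Finset.even_sum
      intro τ hτ
      have hτne := Finset.ne_of_mem_erase hτ
      rw [hfib]
      by_cases hgood : ScarfDom u τ ∧ τ.card + 1 = Fintype.card I ∧ τ.image c = Finset.univ.erase i0
      · obtain ⟨h1, h2, h3⟩ := hgood
        obtain ⟨t, ht, htr⟩ : ∃ t ∈ τ, t ∉ Set.range s := by
          by_contra! hall
          apply hτne
          apply Finset.eq_of_subset_of_card_le
          · intro v hv
            obtain ⟨i, rfl⟩ := hall v hv
            refine (hmemτ0 _).2 ⟨i, ?_, rfl⟩
            have : c (s i) ∈ τ.image c := Finset.mem_image_of_mem _ hv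
            rw [h3, hc] at this
            exact Finset.ne_of_mem_erase this
          · omega
        obtain ⟨a, b, hab, hx⟩ := scarf_door u hu τ h1 h2 ⟨t, ht⟩ fun k =>
          ⟨s k, fun l hl => ⟨t, ht, hs2 k l t hl.symm htr⟩⟩
        have : (Finset.univ.filter fun x => (x ∉ τ ∧ ScarfDom u (insert x τ)) ∧
          τ.card + 1 = Fintype.card I ∧ τ.image c = Finset.univ.erase i0) = {a, b} := by
          ext x
          simp only [Finset.mem_filter, Finset.mem_univ, true_and, h2, h3, and_true, hx,
            Finset.mem_insert, Finset.mem_singleton]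
        rw [this, Finset.card_pair hab]
        decide
      · rw [Finset.filter_eq_empty_iff.2]
        · simp
        · rintro x - ⟨⟨-, h2⟩, h3, h4⟩
          exact hgood ⟨h2.mono (Finset.subset_insert _ _), h3, h4⟩
  exact (Nat.not_even_iff_odd.2 hPo) hPe

lemma scarf_grid {I : Type*} [Fintype I] [DecidableEq I] (i0 : I) (N : ℕ) (c : (I → ℕ) → I) :
    ∃ (C : Finset I) (g : I → I → ℕ), C.Nonempty ∧
      (∀ k ∈ C, ∑ i, g k i = N ∧ c (g k) = k) ∧
      (∀ k ∈ C, ∀ k' ∈ C, ∀ i ∈ C, g k i ≤ g k' i + Fintype.card I) ∧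
      (∀ k ∈ C, ∀ i, i ∉ C → g k i ≤ Fintype.card I) := by
  classical
  let T := {g : I → ℕ // g ∈ Finset.piAntidiag (Finset.univ : Finset I) N}
  have hTsum : ∀ g : T, ∑ i, g.1 i = N := fun g => (Finset.mem_piAntidiag.1 g.2).1
  have hTle : ∀ (g : T) i, g.1 i ≤ N := fun g i => by
    exact (Finset.single_le_sum (f := g.1) (fun _ _ => Nat.zero_le _) (Finset.mem_univ i)).trans
      (hTsum g).le
  have mkT : ∀ g : I → ℕ, ∑ i, g i = N → ∃ t : T, t.1 = g := fun g hg =>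
    ⟨⟨g, by simp [Finset.mem_piAntidiag, hg]⟩, rfl⟩
  let K := Fintype.card T
  let e : T → ℤ := fun g => ((Fintype.equivFin T g : ℕ) : ℤ)
  have he0 : ∀ g, 0 ≤ e g := fun g => by positivity
  have heK : ∀ g, e g < K := fun g => by
    have := (Fintype.equivFin T g).2
    simp only [e, K]; exact_mod_cast this
  have heinj : Function.Injective e := fun a b h => by
    simp only [e, Nat.cast_inj] at h
    exact (Fintype.equivFin T).injective (Fin.ext h)
  let d : I → ℤ := fun i => ((Fintype.equivFin I i : ℕ) : ℤ)
  have hd0 : ∀ g, 0 ≤ d g := fun g => by positivity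
  have hdinj : Function.Injective d := fun a b h => by
    simp only [d, Nat.cast_inj] at h
    exact (Fintype.equivFin I).injective (Fin.ext h)
  let u : I → T ⊕ I → ℤ := fun i v => match v with
    | Sum.inl g => (g.1 i : ℤ) * K + e g
    | Sum.inr j => if j = i then -1 else ((N : ℤ) + 1) * K + d j
  have hul : ∀ i g, u i (Sum.inl g) = (g.1 i : ℤ) * K + e g := fun _ _ => rfl
  have hur : ∀ i j, u i (Sum.inr j) = if j = i then -1 else ((N : ℤ) + 1) * K + d j :=
    fun _ _ => rfl
  have hlt : ∀ (a b : T) i, a.1 i < b.1 i → u i (Sum.inl a) < u i (Sum.inl b) := by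
    intro a b i h
    rw [hul, hul]
    have h1 : (a.1 i : ℤ) + 1 ≤ b.1 i := by exact_mod_cast h
    have h2 : ((a.1 i : ℤ) + 1) * K ≤ b.1 i * K := mul_le_mul_of_nonneg_right h1 (by positivity)
    nlinarith [heK a, he0 b]
  have hpos : ∀ i g, 0 ≤ u i (Sum.inl g) := fun i g => by
    rw [hul]; have := he0 g; positivity
  have hbig : ∀ i g, u i (Sum.inl g) < ((N : ℤ) + 1) * K := fun i g => by
    rw [hul]
    have h1 : (g.1 i : ℤ) ≤ N := by exact_mod_cast hTle g i
    have h2 : (g.1 i : ℤ) * K ≤ N * K := mul_le_mul_of_nonneg_right h1 (by positivity)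
    nlinarith [heK g]
  have hbig0 : (0 : ℤ) ≤ ((N : ℤ) + 1) * K := by positivity
  have hu : ∀ i, Function.Injective (u i) := by
    intro i v w h
    rcases v with a | a <;> rcases w with b | b
    · rcases lt_trichotomy (a.1 i) (b.1 i) with h' | h' | h'
      · exact absurd h (hlt _ _ _ h').ne
      · rw [hul, hul, h'] at h
        rw [heinj (add_left_cancel h)]
      · exact absurd h (hlt _ _ _ h').ne'
    · have h1 := hpos i a
      have h2 := hbig i a
      have h3 := hd0 b
      rw [h, hur] at h1 h2
      split_ifs at h1 h2 <;> omega
    · have h1 := hpos i b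
      have h2 := hbig i b
      have h3 := hd0 a
      rw [← h, hur] at h1 h2
      split_ifs at h1 h2 <;> omega
    · rw [hur, hur] at h
      have h3 := hd0 a
      have h4 := hd0 b
      split_ifs at h with h1 h2 h2
      · rw [h1, h2]
      · omega
      · omega
      · rw [hdinj (add_left_cancel h)]
  obtain ⟨t0, -⟩ := mkT (Pi.single i0 N) (by simp)
  obtain ⟨x, hxc, hx⟩ := scarf u hu Sum.inr
    (by
      intro i v
      rw [hur, if_pos rfl]
      rcases v with a | a
      · linarith [hpos i a]
      · rw [hur]; have := hd0 a; split_ifs <;> omega)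
    (by
      intro i j v hij hv
      rcases v with a | a
      · rw [hur, if_neg hij]; linarith [hbig j a, hd0 i]
      · exact absurd ⟨a, rfl⟩ hv)
    ⟨Sum.inl t0, by simp⟩
    (fun v => match v with
      | Sum.inl g => c g.1
      | Sum.inr j => j) (fun i => rfl) i0
  let C : Finset I := Finset.univ.filter fun i => ∃ t : T, x i = Sum.inl t
  have hC : ∀ i, i ∈ C ↔ ∃ t : T, x i = Sum.inl t := fun i => by simp [C]
  have hnC : ∀ i, i ∉ C → x i = Sum.inr i := by
    intro i hi
    have h := hxc i
    rcases hxi : x i with a | a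
    · exact absurd ((hC i).2 ⟨a, hxi⟩) hi
    · rw [hxi] at h
      simp only at h
      rw [h]
  have hdom : ∀ t : T, ∃ i ∈ C, ∀ k ∈ C, u i (Sum.inl t) ≤ u i (x k) := by
    intro t
    obtain ⟨i, hi⟩ := hx (Sum.inl t)
    refine ⟨i, ?_, fun k _ => hi k⟩
    by_contra h
    have h1 := hi i
    rw [hnC i h, hur, if_pos rfl] at h1
    linarith [hpos i t]
  have hex : ∀ i, ∃ t : T, i ∈ C → x i = Sum.inl t := by
    intro i
    by_cases hi : i ∈ C
    · obtain ⟨t, ht⟩ := (hC i).1 hi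
      exact ⟨t, fun _ => ht⟩
    · exact ⟨t0, fun h => absurd h hi⟩
  choose g hg using hex
  have hCne : C.Nonempty := by
    obtain ⟨i, hi, -⟩ := hdom t0
    exact ⟨i, hi⟩
  have hmin : ∀ i, ∃ k ∈ C, ∀ k' ∈ C, (g k).1 i ≤ (g k').1 i := fun i =>
    C.exists_min_image (fun k => (g k).1 i) hCne
  choose mk hmkC hmk using hmin
  set m : I → ℕ := fun i => (g (mk i)).1 i with hm
  have hsum : N < ∑ i ∈ C, (m i + 1) := by
    by_contra! hle
    obtain ⟨i1, hi1⟩ := hCne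
    obtain ⟨t, ht⟩ := mkT (fun i => (if i ∈ C then m i + 1 else 0) +
        (if i = i1 then N - ∑ i ∈ C, (m i + 1) else 0)) (by
      rw [Finset.sum_add_distrib, Finset.sum_ite_mem, Finset.univ_inter, Finset.sum_ite_eq']
      simp only [Finset.mem_univ, if_true]
      omega)
    obtain ⟨i, hi, h⟩ := hdom t
    have h1 := h (mk i) (hmkC i)
    rw [hg _ (hmkC i)] at h1
    refine absurd h1 (not_le.2 (hlt _ _ _ ?_))
    rw [ht]
    simp only [hi, if_true, hm]
    omega
  have hcardC : C.card ≤ Fintype.card I := Finset.card_le_univ C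
  rw [Finset.sum_add_distrib, Finset.sum_const, smul_eq_mul, mul_one] at hsum
  have hsplit : ∀ k, ∑ i ∈ C, (g k).1 i + ∑ i ∈ Cᶜ, (g k).1 i = N := fun k => by
    rw [Finset.sum_add_sum_compl]; exact hTsum _
  refine ⟨C, fun k => (g k).1, hCne, ?_, ?_, ?_⟩
  · intro k hk
    refine ⟨hTsum _, ?_⟩
    have := hxc k
    rw [hg k hk] at this
    exact this
  · intro k hk k' hk' i hi
    have h1 := hmk i k' hk'
    have h2 : ∑ j ∈ C.erase i, m j ≤ ∑ j ∈ C.erase i, (g k).1 j :=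
      Finset.sum_le_sum fun j _ => hmk j k hk
    have h3 := Finset.add_sum_erase C m hi
    have h4 := Finset.add_sum_erase C (g k).1 hi
    have h5 := hsplit k
    have h6 : m i ≤ (g k').1 i := h1
    show (g k).1 i ≤ (g k').1 i + _
    omega
  · intro k hk i hi
    have h2 : ∑ j ∈ C, m j ≤ ∑ j ∈ C, (g k).1 j :=
      Finset.sum_le_sum fun j _ => hmk j k hk
    have h5 := hsplit k
    have h6 : (g k).1 i ≤ ∑ i ∈ Cᶜ, (g k).1 i :=
      Finset.single_le_sum (f := (g k).1) (fun _ _ => Nat.zero_le _) (Finset.mem_compl.2 hi)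
    show (g k).1 i ≤ _
    omega

lemma brouwer_simplex {I : Type*} [Fintype I] [Nonempty I]
    (f : (I → ℝ) → (I → ℝ)) (hf : ContinuousOn f (stdSimplex ℝ I))
    (hmap : ∀ p ∈ stdSimplex ℝ I, f p ∈ stdSimplex ℝ I) :
    ∃ p ∈ stdSimplex ℝ I, f p = p := by
  classical
  obtain ⟨i0⟩ := ‹Nonempty I›
  have hcomp : IsCompact (stdSimplex ℝ I) := isCompact_stdSimplex ℝ I
  have happ : ∀ ε > 0, ∃ p ∈ stdSimplex ℝ I, ∀ i, p i ≤ f p i + ε := by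
    intro ε hε
    have huc := hcomp.uniformContinuousOn_of_continuous hf
    obtain ⟨δ, hδ, hfδ⟩ := Metric.uniformContinuousOn_iff.1 huc (ε / 2) (by positivity)
    set η := min (δ / 2) (ε / 2) with hη
    have hηpos : 0 < η := by positivity
    obtain ⟨N, hN⟩ := exists_nat_gt ((Fintype.card I : ℝ) / η)
    have hN0 : (0 : ℝ) < N := lt_of_le_of_lt (by positivity) hN
    have hNη : (Fintype.card I : ℝ) / N ≤ η := by
      rw [div_le_iff₀ hN0]; rw [div_lt_iff₀ hηpos] at hN; linarith
    let q : (I → ℕ) → (I → ℝ) := fun g i => (g i : ℝ) / N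
    have hq : ∀ g : I → ℕ, ∑ i, g i = N → q g ∈ stdSimplex ℝ I := by
      intro g hg
      refine ⟨fun i => by positivity, ?_⟩
      simp only [q]
      rw [← Finset.sum_div, ← Nat.cast_sum, hg, div_self hN0.ne']
    have hcol : ∀ g : I → ℕ, ∃ i, ∑ i, g i = N → q g i ≤ f (q g) i := by
      intro g
      by_cases hg : ∑ i, g i = N
      · have h1 := (hq g hg).2
        have h2 := (hmap _ (hq g hg)).2
        obtain ⟨i, -, hi⟩ := Finset.exists_le_of_sum_le (s := Finset.univ) (f := q g) (g := f (q g))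
          ⟨i0, Finset.mem_univ _⟩ (by rw [h1, h2])
        exact ⟨i, fun _ => hi⟩
      · exact ⟨i0, fun h => absurd h hg⟩
    choose c hc using hcol
    obtain ⟨C, g, ⟨k, hk⟩, h1, h2, h3⟩ := scarf_grid i0 N c
    have hpk := hq _ (h1 k hk).1
    refine ⟨q (g k), hpk, fun i => ?_⟩
    have hle : ∀ a b : ℕ, a ≤ b + Fintype.card I → (a : ℝ) / N ≤ (b : ℝ) / N + η := by
      intro a b hab
      have : (a : ℝ) ≤ b + Fintype.card I := by exact_mod_cast hab
      calc (a : ℝ) / N ≤ (b + Fintype.card I) / N := by gcongr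
        _ = b / N + Fintype.card I / N := add_div _ _ _
        _ ≤ _ := by linarith
    have hηε : η ≤ ε / 2 := min_le_right _ _
    by_cases hi : i ∈ C
    · have hqi := hq _ (h1 i hi).1
      have hci := hc (g i) (h1 i hi).1
      rw [(h1 i hi).2] at hci
      have hdist : dist (q (g k)) (q (g i)) < δ := by
        refine lt_of_le_of_lt ((dist_pi_le_iff hηpos.le).2 fun j => ?_)
          (lt_of_le_of_lt (min_le_left _ _) (half_lt_self hδ))
        rw [Real.dist_eq, abs_le]
        have ha : g k j ≤ g i j + Fintype.card I := by
          by_cases hj : j ∈ C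
          · exact h2 k hk i hi j hj
          · exact (h3 k hk j hj).trans (by omega)
        have hb : g i j ≤ g k j + Fintype.card I := by
          by_cases hj : j ∈ C
          · exact h2 i hi k hk j hj
          · exact (h3 i hi j hj).trans (by omega)
        have := hle _ _ ha
        have := hle _ _ hb
        constructor <;> simp only [q] <;> linarith
      have hfd := hfδ _ hpk _ hqi hdist
      have hfi := (dist_le_pi_dist _ _ i).trans_lt hfd
      rw [Real.dist_eq, abs_lt] at hfi
      have h5 := hle _ _ (h2 k hk i hi i hi)
      simp only [q] at *
      linarith
    · have h4 := (hmap _ hpk).1 i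
      have h5 := hle (g k i) 0 (by simpa using h3 k hk i hi)
      simp only [q, Nat.cast_zero, zero_div] at *
      linarith
  obtain ⟨p, hp, hmin⟩ := hcomp.exists_isMinOn (f := fun p => ∑ i, max (p i - f p i) 0)
    ⟨_, (single_mem_stdSimplex ℝ i0)⟩ (by
      refine continuousOn_finsetSum _ fun i _ => ?_
      refine ContinuousOn.sup ?_ continuousOn_const
      exact ((continuous_apply i).continuousOn).sub ((continuous_apply i).comp_continuousOn hf))
  refine ⟨p, hp, ?_⟩
  have hle0 : ∑ i, max (p i - f p i) 0 ≤ 0 := by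
    have hcard : (0 : ℝ) < Fintype.card I := by
      have : 0 < Fintype.card I := Fintype.card_pos_iff.2 ⟨i0⟩
      exact_mod_cast this
    refine le_of_forall_pos_le_add fun ε hε => ?_
    obtain ⟨p', hp', h⟩ := happ (ε / Fintype.card I) (by positivity)
    refine (hmin hp').trans ?_
    calc ∑ i, max (p' i - f p' i) 0 ≤ ∑ _i : I, ε / Fintype.card I := by
          refine Finset.sum_le_sum fun i _ => max_le (by linarith [h i]) (by positivity)
      _ = 0 + ε := by
          rw [Finset.sum_const, Finset.card_univ, nsmul_eq_mul]; field_simp; ring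
  have hall : ∀ i, p i ≤ f p i := by
    intro i
    have h1 := (Finset.single_le_sum (f := fun i => max (p i - f p i) 0)
      (fun _ _ => le_max_right _ _) (Finset.mem_univ i)).trans hle0
    have h2 := (le_max_left (p i - f p i) 0).trans h1
    linarith
  have := (Finset.sum_eq_sum_iff_of_le fun i _ => hall i).1 (hp.2.trans (hmap p hp).2.symm)
  exact funext fun i => (this i (Finset.mem_univ _)).symm

/-- Schauder theorem on a compact convex set -/
lemma schauder_compact {X : Type*} [NormedAddCommGroup X] [NormedSpace ℝ X]
    (K : Set X) (hK : IsCompact K) (hconv : Convex ℝ K) (hne : K.Nonempty)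
    (F : X → X) (hF : ContinuousOn F K) (hmap : ∀ x ∈ K, F x ∈ K) :
    ∃ x ∈ K, F x = x := by
  classical
  have happ : ∀ ε > 0, ∃ x ∈ K, dist (F x) x ≤ ε := by
    intro ε hε
    obtain ⟨t, htK, htf, hcov⟩ := hK.finite_cover_balls hε
    let _ : Fintype t := htf.fintype
    have hcov' : ∀ y ∈ K, ∃ i : t, dist y i < ε := by
      intro y hy
      obtain ⟨i, hi, h⟩ := Set.mem_iUnion₂.1 (hcov hy)
      exact ⟨⟨i, hi⟩, h⟩
    have : Nonempty t := by
      obtain ⟨y, hy⟩ := hne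
      exact ⟨(hcov' y hy).choose⟩
    let φ : t → X → ℝ := fun i y => max (ε - dist y i) 0
    have hφ0 : ∀ i y, 0 ≤ φ i y := fun _ _ => le_max_right _ _
    have hφc : ∀ i, Continuous (φ i) := fun i => by
      simp only [φ]; fun_prop
    let Φ : X → ℝ := fun y => ∑ i, φ i y
    have hΦc : Continuous Φ := by simp only [Φ]; fun_prop
    have hΦpos : ∀ y ∈ K, 0 < Φ y := by
      intro y hy
      obtain ⟨i, hi⟩ := hcov' y hy
      exact Finset.sum_pos' (fun i _ => hφ0 i y) ⟨i, Finset.mem_univ _, lt_max_of_lt_left (by linarith)⟩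
    let S : (t → ℝ) → X := fun p => ∑ i, p i • (i : X)
    have hSc : Continuous S := by simp only [S]; fun_prop
    have hSK : ∀ p ∈ stdSimplex ℝ t, S p ∈ K := fun p hp =>
      hconv.sum_mem (fun i _ => hp.1 i) hp.2 (fun i _ => htK i.2)
    obtain ⟨p, hp, hfix⟩ := brouwer_simplex (I := t) (fun p i => φ i (F (S p)) / Φ (F (S p)))
      (by
        refine continuousOn_pi.2 fun i => ?_
        have h1 : ContinuousOn (fun p => F (S p)) (stdSimplex ℝ t) :=
          hF.comp hSc.continuousOn hSK
        exact ((hφc i).comp_continuousOn h1).div (hΦc.comp_continuousOn h1)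
          fun p hp => (hΦpos _ (hmap _ (hSK p hp))).ne')
      (by
        intro p hp
        have h := hΦpos _ (hmap _ (hSK p hp))
        refine ⟨fun i => div_nonneg (hφ0 _ _) h.le, ?_⟩
        rw [← Finset.sum_div]
        exact div_self h.ne')
    refine ⟨S p, hSK p hp, ?_⟩
    set y := F (S p) with hy
    have hyball : S p ∈ Metric.closedBall y ε := by
      have hp' : ∀ i, φ i y / Φ y = p i := fun i => congrFun hfix i
      -- drop the zero weights
      have h1 : S p = ∑ i ∈ Finset.univ.filter (fun i => p i ≠ 0), p i • (i : X) := by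
        rw [Finset.sum_filter_of_ne]
        intro i _ h h0
        exact h (by rw [h0, zero_smul])
      have h2 : ∑ i ∈ Finset.univ.filter (fun i => p i ≠ 0), p i = 1 := by
        rw [Finset.sum_filter_ne_zero]; exact hp.2
      rw [h1]
      refine (convex_closedBall y ε).sum_mem (fun i _ => hp.1 i) h2 fun i hi => ?_
      have hi' := (Finset.mem_filter.1 hi).2
      rw [← hp' i] at hi'
      have hφi : φ i y ≠ 0 := fun h => hi' (by rw [h, zero_div])
      rw [Metric.mem_closedBall, dist_comm]
      by_contra! hcon
      exact hφi (max_eq_right (by linarith))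
    rw [dist_comm]; exact hyball
  obtain ⟨x, hx, hmin⟩ := hK.exists_isMinOn (f := fun x => dist (F x) x) hne
    (continuous_dist.comp_continuousOn (hF.prodMk continuousOn_id))
  refine ⟨x, hx, dist_le_zero.1 (le_of_forall_pos_le_add fun ε hε => ?_)⟩
  obtain ⟨x', hx', h⟩ := happ ε hε
  rw [zero_add]
  exact (hmin hx').trans h

/-- Kuratowski covering property: `S` splits into finitely many pieces of diameter at most `d`. -/
def Kur {X : Type*} [PseudoMetricSpace X] (S : Set X) (d : ℝ) : Prop :=
  ∃ (n : ℕ) (k : X → Fin n), ∀ x ∈ S, ∀ y ∈ S, k x = k y → dist x y ≤ d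

lemma Kur.of_finite {X ι : Type*} [PseudoMetricSpace X] [Finite ι] {S : Set X} {d : ℝ} (k : X → ι)
    (h : ∀ x ∈ S, ∀ y ∈ S, k x = k y → dist x y ≤ d) : Kur S d := by
  refine ⟨Nat.card ι, fun x => Finite.equivFin ι (k x), fun x hx y hy hxy => h x hx y hy ?_⟩
  exact (Finite.equivFin ι).injective hxy

lemma Kur.subset {X : Type*} [PseudoMetricSpace X] {S T : Set X} {d : ℝ} (h : Kur T d)
    (hs : S ⊆ T) : Kur S d := by
  obtain ⟨n, k, h⟩ := h
  exact ⟨n, k, fun x hx y hy => h x (hs hx) y (hs hy)⟩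

lemma Kur.of_totallyBounded {X : Type*} [PseudoMetricSpace X] {S : Set X} (h : TotallyBounded S)
    {ε : ℝ} (hε : 0 < ε) : Kur S ε := by
  classical
  obtain ⟨t, ht, hS⟩ := Metric.totallyBounded_iff.1 h (ε / 2) (by positivity)
  have : ∀ x, ∃ o : Option t, x ∈ S → ∃ c : t, o = some c ∧ dist x c < ε / 2 := by
    intro x
    by_cases hx : x ∈ S
    · obtain ⟨c, hc, hxc⟩ := Set.mem_iUnion₂.1 (hS hx)
      exact ⟨some ⟨c, hc⟩, fun _ => ⟨⟨c, hc⟩, rfl, hxc⟩⟩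
    · exact ⟨none, fun h => absurd h hx⟩
  choose k hk using this
  have := ht.to_subtype
  refine Kur.of_finite k fun x hx y hy hxy => ?_
  obtain ⟨c, h1, h2⟩ := hk x hx
  obtain ⟨c', h3, h4⟩ := hk y hy
  have hcc : c = c' := by rw [hxy, h3] at h1; exact (Option.some.inj h1).symm
  subst hcc
  have := dist_triangle_right x y c
  linarith

lemma Kur.totallyBounded {X : Type*} [PseudoMetricSpace X] {S : Set X}
    (h : ∀ ε > 0, Kur S ε) : TotallyBounded S := by
  classical
  refine Metric.totallyBounded_iff.2 fun ε hε => ?_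
  obtain ⟨n, k, hk⟩ := h (ε / 2) (by positivity)
  rcases S.eq_empty_or_nonempty with rfl | ⟨x0, hx0⟩
  · exact ⟨∅, Set.finite_empty, by simp⟩
  have : ∀ i : Fin n, ∃ z, ∀ x ∈ S, k x = i → dist x z ≤ ε / 2 := by
    intro i
    by_cases hi : ∃ x ∈ S, k x = i
    · obtain ⟨z, hz, rfl⟩ := hi
      exact ⟨z, fun x hx hxz => hk x hx z hz hxz⟩
    · exact ⟨x0, fun x hx h => absurd ⟨x, hx, h⟩ hi⟩
  choose z hz using this
  refine ⟨Set.range z, Set.finite_range z, fun x hx => ?_⟩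
  exact Set.mem_iUnion₂.2 ⟨z (k x), ⟨_, rfl⟩, lt_of_le_of_lt (hz _ x hx rfl) (half_lt_self hε)⟩

lemma Kur.closure {X : Type*} [PseudoMetricSpace X] {S : Set X} {d : ℝ} (h : Kur S d)
    {ε : ℝ} (hε : 0 < ε) : Kur (closure S) (d + ε) := by
  obtain ⟨n, k, hk⟩ := h
  have : ∀ x, ∃ y, x ∈ _root_.closure S → y ∈ S ∧ dist x y < ε / 2 := by
    intro x
    by_cases hx : x ∈ _root_.closure S
    · obtain ⟨y, hy, h⟩ := Metric.mem_closure_iff.1 hx (ε / 2) (by positivity)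
      exact ⟨y, fun _ => ⟨hy, h⟩⟩
    · exact ⟨x, fun h => absurd h hx⟩
  choose p hp using this
  refine ⟨n, fun x => k (p x), fun x hx y hy hxy => ?_⟩
  have h1 := hp x hx
  have h2 := hp y hy
  have h3 := hk _ h1.1 _ h2.1 hxy
  have h4 := dist_triangle4 x (p x) (p y) y
  rw [dist_comm (p y) y] at h4
  linarith

lemma Kur.insert {X : Type*} [PseudoMetricSpace X] {S : Set X} {d : ℝ} (h : Kur S d) (hd : 0 ≤ d)
    (a : X) : Kur (insert a S) d := by
  classical
  obtain ⟨n, k, hk⟩ := h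
  refine Kur.of_finite (ι := Option (Fin n)) (fun x => if x = a then none else some (k x)) ?_
  intro x hx y hy hxy
  by_cases hxa : x = a <;> by_cases hya : y = a
  · rw [hxa, hya, dist_self]; exact hd
  · simp [hxa, hya] at hxy
  · simp [hxa, hya] at hxy
  · simp only [hxa, hya, if_false, Option.some.injEq] at hxy
    exact hk x (hx.resolve_left hxa) y (hy.resolve_left hya) hxy

lemma Kur.convexHull {X : Type*} [NormedAddCommGroup X] [NormedSpace ℝ X] {S : Set X} {d R : ℝ}
    (h : Kur S d) (hd : 0 ≤ d) (hR : ∀ x ∈ S, ‖x‖ ≤ R) (hR0 : 0 ≤ R)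
    {ε : ℝ} (hε : 0 < ε) : Kur (convexHull ℝ S) (d + ε) := by
  classical
  obtain ⟨n, k, hk⟩ := h
  let C0 : Fin n → Set X := fun i => {x | x ∈ S ∧ k x = i}
  have hC0d : ∀ i, ∀ x ∈ _root_.convexHull ℝ (C0 i), ∀ y ∈ _root_.convexHull ℝ (C0 i),
      dist x y ≤ d := by
    intro i x hx y hy
    have h1 : Metric.ediam (_root_.convexHull ℝ (C0 i)) ≤ ENNReal.ofReal d := by
      rw [convexHull_ediam]
      refine Metric.ediam_le fun a ha b hb => ?_
      rw [edist_dist]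
      exact ENNReal.ofReal_le_ofReal (hk a ha.1 b hb.1 (ha.2.trans hb.2.symm))
    have h2 := (Metric.edist_le_ediam_of_mem hx hy).trans h1
    rw [edist_dist] at h2
    exact (ENNReal.ofReal_le_ofReal_iff hd).1 h2
  obtain ⟨C, hCconv, hCd, hCR, hCne, hCS⟩ : ∃ C : Fin n → Set X, (∀ i, Convex ℝ (C i)) ∧
      (∀ i, ∀ x ∈ C i, ∀ y ∈ C i, dist x y ≤ d) ∧ (∀ i, ∀ x ∈ C i, ‖x‖ ≤ R) ∧
      (∀ i, (C i).Nonempty) ∧ ∀ x ∈ S, x ∈ C (k x) := by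
    refine ⟨fun i => if (C0 i).Nonempty then _root_.convexHull ℝ (C0 i) else {0}, ?_, ?_, ?_, ?_, ?_⟩
    · intro i
      dsimp only
      split_ifs
      · exact convex_convexHull _ _
      · exact convex_singleton _
    · intro i
      dsimp only
      split_ifs
      · exact hC0d i
      · rintro x rfl y rfl; simpa using hd
    · intro i
      dsimp only
      split_ifs
      · intro x hx
        have : _root_.convexHull ℝ (C0 i) ⊆ Metric.closedBall 0 R :=
          convexHull_min (fun x hx => by simpa using hR x hx.1) (convex_closedBall _ _)
        simpa using this hx
      · rintro x rfl; simpa using hR0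
    · intro i
      dsimp only
      split_ifs with h
      · exact h.convexHull
      · exact Set.singleton_nonempty _
    · intro x hx
      have hne : (C0 (k x)).Nonempty := ⟨x, hx, rfl⟩
      dsimp only
      rw [if_pos hne]
      exact subset_convexHull _ _ ⟨hx, rfl⟩
  choose z0 hz0 using hCne
  let D : Set X := {z | ∃ l ∈ stdSimplex ℝ (Fin n), ∃ y : Fin n → X, (∀ i, y i ∈ C i) ∧
    z = ∑ i, l i • y i}
  have hSD : _root_.convexHull ℝ S ⊆ D := by
    refine convexHull_min ?_ ?_
    · intro x hx
      refine ⟨Pi.single (k x) 1, single_mem_stdSimplex ℝ _, Function.update z0 (k x) x, ?_, ?_⟩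
      · intro i
        by_cases hi : i = k x
        · subst hi; simpa using hCS x hx
        · simpa [hi] using hz0 i
      · rw [Finset.sum_eq_single (k x)]
        · simp
        · intro i _ hi; simp [hi]
        · simp
    · rintro _ ⟨l, hl, y, hy, rfl⟩ _ ⟨l', hl', y', hy', rfl⟩ a b ha hb hab
      have : ∀ i, ∃ w ∈ C i, (a * l i + b * l' i) • w = (a * l i) • y i + (b * l' i) • y' i :=
        fun i => (hCconv i).exists_mem_add_smul_eq (hy i) (hy' i) (mul_nonneg ha (hl.1 i))
          (mul_nonneg hb (hl'.1 i))
      choose w hw hweq using this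
      refine ⟨fun i => a * l i + b * l' i,
        convex_stdSimplex ℝ (Fin n) hl hl' ha hb hab, w, hw, ?_⟩
      simp only [hweq, Finset.sum_add_distrib, Finset.smul_sum, smul_smul]
  have hchoose : ∀ z, ∃ (l : Fin n → ℝ) (y : Fin n → X), z ∈ _root_.convexHull ℝ S →
      l ∈ stdSimplex ℝ (Fin n) ∧ (∀ i, y i ∈ C i) ∧ z = ∑ i, l i • y i := by
    intro z
    by_cases hz : z ∈ _root_.convexHull ℝ S
    · obtain ⟨l, hl, y, hy, h⟩ := hSD hz
      exact ⟨l, y, fun _ => ⟨hl, hy, h⟩⟩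
    · exact ⟨0, 0, fun h => absurd h hz⟩
  choose l y hly using hchoose
  set η := ε / ((n + 1) * (R + 1)) with hη
  have hηpos : 0 < η := by positivity
  obtain ⟨n', k', hk'⟩ := Kur.of_totallyBounded (isCompact_stdSimplex ℝ (Fin n)).totallyBounded hηpos
  refine ⟨n', fun z => k' (l z), fun z hz z' hz' hzz => ?_⟩
  obtain ⟨h1, h2, h3⟩ := hly z hz
  obtain ⟨h1', h2', h3'⟩ := hly z' hz'
  have hdist := hk' _ h1 _ h1' hzz
  have key : z - z' = ∑ i, l z i • (y z i - y z' i) + ∑ i, (l z i - l z' i) • y z' i := by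
    conv_lhs => rw [h3, h3']
    rw [← Finset.sum_sub_distrib, ← Finset.sum_add_distrib]
    refine Finset.sum_congr rfl fun i _ => ?_
    rw [smul_sub, sub_smul]; abel
  rw [dist_eq_norm, key]
  refine (norm_add_le _ _).trans (add_le_add ?_ ?_)
  · calc ‖∑ i, l z i • (y z i - y z' i)‖ ≤ ∑ i, l z i * d := by
          refine norm_sum_le_of_le _ fun i _ => ?_
          rw [norm_smul, Real.norm_of_nonneg (h1.1 i), ← dist_eq_norm]
          exact mul_le_mul_of_nonneg_left (hCd i _ (h2 i) _ (h2' i)) (h1.1 i)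
      _ = d := by rw [← Finset.sum_mul, h1.2, one_mul]
  · calc ‖∑ i, (l z i - l z' i) • y z' i‖ ≤ ∑ _i : Fin n, η * R := by
          refine norm_sum_le_of_le _ fun i _ => ?_
          rw [norm_smul, ← dist_eq_norm]
          exact mul_le_mul ((dist_le_pi_dist _ _ i).trans hdist) (hCR i _ (h2' i)) (norm_nonneg _)
            hηpos.le
      _ = n * (η * R) := by simp
      _ ≤ (n + 1) * (η * (R + 1)) := by gcongr <;> linarith
      _ = ε := by rw [hη]; field_simp

/-- Darbo theorem in the form needed here. -/
lemma darbo {X : Type*} [NormedAddCommGroup X] [NormedSpace ℝ X] [CompleteSpace X]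
    (r R q : ℝ) (hr : 0 < r) (hq : q < 1) (hq0 : 0 ≤ q) (T F : X → X)
    (hF : ContinuousOn F (Metric.closedBall 0 r))
    (hFm : ∀ x ∈ Metric.closedBall (0 : X) r, F x ∈ Metric.closedBall (0 : X) r)
    (hFT : ∀ x ∈ Metric.closedBall (0 : X) r, F x ∈ segment ℝ 0 (T x))
    (hR : ∀ x ∈ Metric.closedBall (0 : X) r, ‖T x‖ ≤ R)
    (hT : ∀ K ⊆ Metric.closedBall (0 : X) r, ∀ d, 0 ≤ d → Kur K d → ∀ ε > 0,
      Kur (T '' K) (q * d + ε)) :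
    ∃ x ∈ Metric.closedBall (0 : X) r, F x = x := by
  let 𝒬 : Set (Set X) := {Q | IsClosed Q ∧ Convex ℝ Q ∧ (0 : X) ∈ Q ∧
    Q ⊆ Metric.closedBall 0 r ∧ ∀ x ∈ Q, F x ∈ Q}
  have h0 : (0 : X) ∈ Metric.closedBall (0 : X) r := by simp [hr.le]
  have hR0 : 0 ≤ R := (norm_nonneg _).trans (hR 0 h0)
  have hball : Metric.closedBall (0 : X) r ∈ 𝒬 :=
    ⟨Metric.isClosed_closedBall, convex_closedBall _ _, h0, subset_rfl, hFm⟩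
  let K := ⋂₀ 𝒬
  have hK : K ∈ 𝒬 := by
    refine ⟨isClosed_sInter fun Q hQ => hQ.1, convex_sInter fun Q hQ => hQ.2.1,
      fun Q hQ => hQ.2.2.1, Set.sInter_subset_of_mem hball, fun x hx Q hQ => ?_⟩
    exact hQ.2.2.2.2 x (hx Q hQ)
  obtain ⟨hKcl, hKconv, hK0, hKb, hKF⟩ := hK
  have hKsub : K ⊆ closure (convexHull ℝ (insert 0 (T '' K))) := by
    have hmem : closure (convexHull ℝ (insert 0 (T '' K))) ∩ K ∈ 𝒬 := by
      refine ⟨isClosed_closure.inter hKcl, (convex_convexHull ℝ _).closure.inter hKconv,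
        ⟨subset_closure (subset_convexHull _ _ (Set.mem_insert _ _)), hK0⟩,
        Set.inter_subset_right.trans hKb, fun x hx => ⟨subset_closure ?_, hKF x hx.2⟩⟩
      exact segment_subset_convexHull (Set.mem_insert _ _)
        (Set.mem_insert_of_mem _ (Set.mem_image_of_mem T hx.2)) (hFT x (hKb hx.2))
    exact (Set.sInter_subset_of_mem hmem).trans Set.inter_subset_left
  have hstep : ∀ d, 0 ≤ d → Kur K d → ∀ ε > 0, Kur K (q * d + ε) := by
    intro d hd hKd ε hε
    have h1 := hT K hKb d hd hKd (ε / 3) (by positivity)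
    have h2 : 0 ≤ q * d + ε / 3 := by positivity
    have h3 := ((h1.insert h2 0).convexHull h2 (R := R) (by
      rintro x (rfl | ⟨y, hy, rfl⟩)
      · simpa using hR0
      · exact hR y (hKb hy)) hR0 (ε := ε / 3) (by positivity)).closure (ε := ε / 3) (by positivity)
    have h4 := h3.subset hKsub
    convert h4 using 1
    ring
  let E : Set ℝ := {d | 0 ≤ d ∧ Kur K d}
  have hEbdd : BddBelow E := ⟨0, fun d hd => hd.1⟩
  have hEne : E.Nonempty := by
    refine ⟨2 * r, by positivity, 1, fun _ => 0, fun x hx y hy _ => ?_⟩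
    have h1 := Metric.mem_closedBall.1 (hKb hx)
    have h2 := Metric.mem_closedBall.1 (hKb hy)
    have := dist_triangle_right x y 0
    linarith
  have hE0 : sInf E ≤ 0 := by
    by_contra! hpos
    set a := sInf E with ha
    set η := (1 - q) * a / 2 with hη
    have hηpos : 0 < η := by have : 0 < 1 - q := by linarith
                             positivity
    obtain ⟨d, hd, hda⟩ := exists_lt_of_csInf_lt hEne (show sInf E < a + η by linarith)
    have h1 : q * d + η ∈ E :=
      ⟨by have := hd.1; positivity, hstep d hd.1 hd.2 η hηpos⟩
    have h2 : a ≤ q * d + η := csInf_le hEbdd h1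
    have h3 : q * d ≤ q * (a + η) := mul_le_mul_of_nonneg_left hda.le hq0
    have h4 : q * η < η := by nlinarith
    have h5 : 2 * η = a - q * a := by rw [hη]; ring
    nlinarith
  have hKcomp : IsCompact K := by
    refine isCompact_iff_totallyBounded_isComplete.2
      ⟨Kur.totallyBounded fun ε hε => ?_, hKcl.isComplete⟩
    obtain ⟨d, hd, hdε⟩ := exists_lt_of_csInf_lt hEne (lt_of_le_of_lt hE0 hε)
    obtain ⟨n, k, hk⟩ := hd.2
    exact ⟨n, k, fun x hx y hy h => (hk x hx y hy h).trans hdε.le⟩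
  obtain ⟨x, hx, hfix⟩ := schauder_compact K hKcomp hKconv ⟨0, hK0⟩ F (hF.mono hKb) hKF
  exact ⟨x, hKb hx, hfix⟩

theorem dhage_fixed_point
    {X : Type*} [NormedRing X] [NormedAlgebra ℝ X] [CompleteSpace X]
    (r : ℝ) (hr : 0 < r)
    (A B : X → X) (L_A M : ℝ)
    (hA : ∀ x ∈ Metric.closedBall (0:X) r, ∀ y ∈ Metric.closedBall (0:X) r,
      ‖A x - A y‖ ≤ L_A * ‖x - y‖)
    (hBcont : ContinuousOn B (Metric.closedBall (0:X) r))
    (hBcompact : IsCompact (closure (B '' Metric.closedBall (0:X) r)))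
    (hM : M = ⨆ x : Metric.closedBall (0:X) r, ‖B x‖)
    (hLM : L_A * M < 1) :
    (∃ x ∈ Metric.closedBall (0:X) r, A x * B x = x) ∨
    (∃ x : X, ‖x‖ = r ∧ ∃ lam ∈ Set.Ioo (0:ℝ) 1, lam • (A x * B x) = x) := by
  have h0 : (0 : X) ∈ Metric.closedBall (0 : X) r := by simp [hr.le]
  have hBM : ∀ x ∈ Metric.closedBall (0 : X) r, ‖B x‖ ≤ M := by
    obtain ⟨b, hb⟩ := hBcompact.isBounded.exists_norm_le
    intro x hx
    rw [hM]
    exact le_ciSup (f := fun x : Metric.closedBall (0:X) r => ‖B x‖)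
      ⟨b, by
        rintro _ ⟨y, rfl⟩
        exact hb _ (subset_closure ⟨y, y.2, rfl⟩)⟩ ⟨x, hx⟩
  have hM0 : 0 ≤ M := (norm_nonneg _).trans (hBM 0 h0)
  set L := max L_A 0 with hL
  have hL0 : 0 ≤ L := le_max_right _ _
  have hA' : ∀ x ∈ Metric.closedBall (0:X) r, ∀ y ∈ Metric.closedBall (0:X) r,
      ‖A x - A y‖ ≤ L * ‖x - y‖ := fun x hx y hy =>
    (hA x hx y hy).trans (mul_le_mul_of_nonneg_right (le_max_left _ _) (norm_nonneg _))
  have hq : L * M < 1 := by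
    rcases max_choice L_A 0 with h | h <;> rw [hL, h]
    · exact hLM
    · simp
  have hAc : ContinuousOn A (Metric.closedBall 0 r) := by
    refine LipschitzOnWith.continuousOn (K := ⟨L, hL0⟩)
      (LipschitzOnWith.of_dist_le_mul fun x hx y hy => ?_)
    rw [dist_eq_norm, dist_eq_norm]
    exact hA' x hx y hy
  set a := ‖A 0‖ + L * r with ha
  have ha0 : 0 ≤ a := by positivity
  have hAb : ∀ x ∈ Metric.closedBall (0 : X) r, ‖A x‖ ≤ a := by
    intro x hx
    have h1 := hA' x hx 0 h0
    have h2 : ‖x - 0‖ ≤ r := by simpa using hx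
    have h3 := norm_le_norm_add_norm_sub' (A x) (A 0)
    have h4 := mul_le_mul_of_nonneg_left h2 hL0
    linarith
  let T : X → X := fun x => A x * B x
  have hTc : ContinuousOn T (Metric.closedBall 0 r) := hAc.mul hBcont
  let F : X → X := fun x => (r / max r ‖T x‖) • T x
  have hmax : ∀ x, 0 < max r ‖T x‖ := fun x => lt_max_of_lt_left hr
  obtain ⟨x, hx, hfix⟩ := darbo r (a * M) (L * M) hr hq (by positivity) T F
    (by
      refine ContinuousOn.smul (ContinuousOn.div continuousOn_const ?_ fun x _ => (hmax x).ne') hTc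
      exact ContinuousOn.sup continuousOn_const hTc.norm)
    (by
      intro x _
      rw [mem_closedBall_zero_iff, norm_smul, Real.norm_of_nonneg (by have := hmax x; positivity),
        div_mul_eq_mul_div, div_le_iff₀ (hmax x)]
      exact mul_le_mul_of_nonneg_left (le_max_right _ _) hr.le)
    (by
      intro x _
      refine ⟨1 - r / max r ‖T x‖, r / max r ‖T x‖, ?_, by have := hmax x; positivity, by ring,
        by simp [F]⟩
      rw [sub_nonneg, div_le_one (hmax x)]
      exact le_max_left _ _)
    (by
      intro x hx
      exact (norm_mul_le _ _).trans (mul_le_mul (hAb x hx) (hBM x hx) (norm_nonneg _) ha0))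
    (by
      intro K hK d hd hKd ε hε
      obtain ⟨n, k, hk⟩ := hKd
      obtain ⟨n', k', hk'⟩ := Kur.of_totallyBounded hBcompact.totallyBounded
        (show 0 < ε / (a + 1) by positivity)
      have : ∀ z, ∃ x, z ∈ T '' K → x ∈ K ∧ T x = z := by
        intro z
        by_cases hz : z ∈ T '' K
        · obtain ⟨x, hx, h⟩ := hz
          exact ⟨x, fun _ => ⟨hx, h⟩⟩
        · exact ⟨z, fun h => absurd h hz⟩
      choose p hp using this
      refine Kur.of_finite (ι := Fin n × Fin n') (fun z => (k (p z), k' (B (p z))))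
        fun z hz z' hz' hzz => ?_
      obtain ⟨h1, h2⟩ := hp z hz
      obtain ⟨h1', h2'⟩ := hp z' hz'
      simp only [Prod.mk.injEq] at hzz
      have e1 := hk _ h1 _ h1' hzz.1
      have e2 := hk' _ (subset_closure ⟨_, hK h1, rfl⟩) _ (subset_closure ⟨_, hK h1', rfl⟩) hzz.2
      rw [dist_eq_norm] at e1 e2
      have e3 := hA' _ (hK h1) _ (hK h1')
      have key : z - z' = (A (p z) - A (p z')) * B (p z) + A (p z') * (B (p z) - B (p z')) := by
        conv_lhs => rw [← h2, ← h2']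
        simp only [T]
        noncomm_ring
      rw [dist_eq_norm, key]
      refine (norm_add_le _ _).trans (add_le_add ?_ ?_)
      · calc _ ≤ ‖A (p z) - A (p z')‖ * ‖B (p z)‖ := norm_mul_le _ _
          _ ≤ (L * d) * M := by
            refine mul_le_mul (e3.trans (mul_le_mul_of_nonneg_left e1 hL0)) (hBM _ (hK h1))
              (norm_nonneg _) (by positivity)
          _ = _ := by ring
      · calc _ ≤ ‖A (p z')‖ * ‖B (p z) - B (p z')‖ := norm_mul_le _ _
          _ ≤ (a + 1) * (ε / (a + 1)) := by
            refine mul_le_mul ((hAb _ (hK h1')).trans (by linarith)) e2 (norm_nonneg _)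
              (by positivity)
          _ = ε := by field_simp)
  by_cases hle : ‖T x‖ ≤ r
  · left
    refine ⟨x, hx, ?_⟩
    have : F x = T x := by
      simp only [F]
      rw [max_eq_left hle, div_self hr.ne', one_smul]
    exact this.symm.trans hfix
  · right
    push Not at hle
    have hT0 : 0 < ‖T x‖ := hr.trans hle
    have hF : F x = (r / ‖T x‖) • T x := by
      simp only [F]
      rw [max_eq_right hle.le]
    refine ⟨x, ?_, r / ‖T x‖, ⟨by positivity, (div_lt_one hT0).2 hle⟩, hF.symm.trans hfix⟩
    rw [← hfix, hF, norm_smul, Real.norm_of_nonneg (by positivity)]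
    field_simp
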